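/- Let k ≥ 2 and d ≥ 1 be fixed integers. There exists a constant C > 0, depending only on k and d, such that for every odd prime power q and every admissible symmetric polynomial f ∈ F_q[x_1,…,x_k] of total degree d, the set B of tuples (u_2(0), u_2(1), …, u_k(0), u_k(1)) ∈ F_q^{2k−2} for which the univariate polynomial ∏_{(ε_2,…,ε_k) ∈ {0,1}^{k−1}} f(x, u_2(ε_2), u_3(ε_3), …, u_k(ε_k)) is a constant multiple of the square of a polynomial in F_q[x] satisfies |B| ≤ C·q^{2k−3}. -/

import Mathlib

open MvPolynomial

/-- Substitute: variable `0` of `f` is kept as the polynomial indeterminate `X`, and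
variable `j+1` is replaced by `u j`.  This produces the univariate polynomial
`f(x, u_2, …, u_k)`. -/
noncomputable def substX {F : Type*} [Field F] {k : ℕ} (f : MvPolynomial (Fin k) F)
    (u : Fin (k - 1) → F) : Polynomial F :=
  MvPolynomial.aeval (fun i : Fin k =>
    if h : (i : ℕ) = 0 then (Polynomial.X : Polynomial F)
    else Polynomial.C (u ⟨(i : ℕ) - 1, by have := i.isLt; omega⟩)) f

/-- `f` is admissible: not a constant multiple of a square, and the coefficients of `f` as
a polynomial in `x_1` have no common zero over the algebraic closure. -/
def Admissible {F : Type*} [Field F] {k : ℕ} (f : MvPolynomial (Fin k) F) : Prop :=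
  (¬ ∃ (c : F) (g : MvPolynomial (Fin k) F), f = MvPolynomial.C c * g ^ 2) ∧
  ∀ v : Fin (k - 1) → AlgebraicClosure F,
    substX (MvPolynomial.map (algebraMap F (AlgebraicClosure F)) f) v ≠ 0

/-- The set `B` of tuples `(u_2(0),u_2(1),…,u_k(0),u_k(1))` such that the product
`∏_{ε ∈ {0,1}^{k-1}} f(x, u_2(ε_2),…,u_k(ε_k))` is a constant multiple of the square of a
polynomial in `F_q[x]`. -/
def badSet {F : Type*} [Field F] {k : ℕ} (f : MvPolynomial (Fin k) F) :
    Set (Fin (k - 1) → Bool → F) :=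
  {u | ∃ (c : F) (g : Polynomial F),
    (∏ ε : Fin (k - 1) → Bool, substX f (fun i => u i (ε i))) = Polynomial.C c * g ^ 2}


lemma aux_sqrt {F : Type} [Field F] (h2 : (2:F) ≠ 0) {n : ℕ} (d m : ℕ)
    (p : Polynomial (MvPolynomial (Fin n) F)) (hp0 : p ≠ 0) (hp : p.natDegree = 2 * m)
    (hd : ∀ j, (p.coeff j).totalDegree ≤ d) (i : ℕ) (hi : i ≤ m) :
    ∃ (s : MvPolynomial (Fin n) F) (G E : Polynomial (MvPolynomial (Fin n) F)),
      s ≠ 0 ∧ G.coeff m ≠ 0 ∧ G.natDegree ≤ m ∧ Polynomial.C s * p = G ^ 2 + E ∧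
      (∀ j, 2 * m - i ≤ j → E.coeff j = 0) ∧ s.totalDegree ≤ 3 ^ i * (2 * d) ∧
      (∀ j, (G.coeff j).totalDegree ≤ 3 ^ i * (2 * d)) ∧
      (∀ j, (E.coeff j).totalDegree ≤ 3 ^ i * (2 * d)) := by
  induction i with
  | zero =>
    have hA : p.coeff (2 * m) ≠ 0 := by
      rw [← hp]; exact Polynomial.leadingCoeff_ne_zero.mpr hp0
    refine ⟨p.coeff (2*m), Polynomial.C (p.coeff (2*m)) * Polynomial.X ^ m,
      Polynomial.C (p.coeff (2*m)) * (p - Polynomial.C (p.coeff (2*m)) * Polynomial.X ^ (2 * m)),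
      hA, ?_, ?_, ?_, ?_, ?_, ?_, ?_⟩
    · simpa using hA
    · exact Polynomial.natDegree_C_mul_X_pow_le _ _
    · ring
    · intro j hj
      rw [Polynomial.coeff_C_mul, Polynomial.coeff_sub, Polynomial.coeff_C_mul_X_pow]
      split_ifs with h
      · subst h; simp
      · rw [Polynomial.coeff_eq_zero_of_natDegree_lt (p := p) (n := j) (by omega)]; simp
    · have := hd (2*m); omega
    · intro j
      rw [Polynomial.coeff_C_mul_X_pow]
      split_ifs
      · have := hd (2*m); omega
      · simp
    · intro j
      rw [Polynomial.coeff_C_mul, Polynomial.coeff_sub, Polynomial.coeff_C_mul_X_pow]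
      refine (totalDegree_mul _ _).trans ?_
      have h1 := hd (2*m)
      have h3 := hd j
      have := totalDegree_sub (p.coeff j) (if j = 2*m then p.coeff (2*m) else 0)
      have h4 : (if j = 2*m then p.coeff (2*m) else 0).totalDegree ≤ d := by
        split_ifs
        · exact h1
        · simp
      have := max_le h3 h4
      omega
  | succ i ih =>
    obtain ⟨s, G, E, hs, hG, hGd, heq, hE, bs, bG, bE⟩ := ih (by omega)
    set B := 3 ^ i * (2 * d) with hB
    have hB' : 3 ^ (i+1) * (2 * d) = 3 * B := by rw [hB]; ring
    set g := G.coeff m with hg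
    set e := E.coeff (2 * m - i - 1) with he
    have h2' : (2 : MvPolynomial (Fin n) F) ≠ 0 := by
      intro h
      apply h2
      have := congrArg (MvPolynomial.coeff 0) h
      rw [← map_ofNat (MvPolynomial.C (σ := Fin n) (R := F)) 2] at this
      simpa using this
    have b2 : (2 : MvPolynomial (Fin n) F).totalDegree = 0 := by
      rw [← map_ofNat (MvPolynomial.C (σ := Fin n) (R := F)) 2]; exact totalDegree_C _
    have mulb : ∀ (a b : MvPolynomial (Fin n) F) (x y : ℕ), a.totalDegree ≤ x → b.totalDegree ≤ y →
        (a * b).totalDegree ≤ x + y := fun a b x y ha hb =>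
      (totalDegree_mul a b).trans (add_le_add ha hb)
    have bl : (2 * g).totalDegree ≤ B := by
      have := mulb 2 g 0 B b2.le (bG m); omega
    obtain ⟨r, hr⟩ : ∃ r, m = r + i + 1 := ⟨m - i - 1, by omega⟩
    refine ⟨(2*g)^2 * s, Polynomial.C (2*g) * G + Polynomial.C e * Polynomial.X ^ r,
      Polynomial.C ((2*g)^2) * E - Polynomial.C (2 * (2*g) * e) * (G * Polynomial.X ^ r)
        - Polynomial.C (e^2) * Polynomial.X ^ (2 * r), ?_, ?_, ?_, ?_, ?_, ?_, ?_, ?_⟩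
    · positivity
    · rw [Polynomial.coeff_add, Polynomial.coeff_C_mul, Polynomial.coeff_C_mul_X_pow,
        if_neg (by omega), add_zero]
      exact mul_ne_zero (mul_ne_zero h2' hG) hG
    · refine Polynomial.natDegree_add_le_of_degree_le ?_ ?_
      · exact (Polynomial.natDegree_C_mul_le _ _).trans hGd
      · exact (Polynomial.natDegree_C_mul_X_pow_le _ _).trans (by omega)
    · rw [Polynomial.C_mul, mul_assoc, heq]
      simp only [Polynomial.C_mul, Polynomial.C_pow]
      have : Polynomial.C (2 : MvPolynomial (Fin n) F) = 2 := map_ofNat _ 2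
      rw [this]
      ring
    · intro j hj
      rw [Polynomial.coeff_sub, Polynomial.coeff_sub, Polynomial.coeff_C_mul, Polynomial.coeff_C_mul,
        Polynomial.coeff_C_mul_X_pow, if_neg (by omega), Polynomial.coeff_mul_X_pow', if_pos (by omega)]
      rcases eq_or_lt_of_le hj with h | h
      · have h3 : j - r = m := by omega
        have h4 : j = 2 * m - i - 1 := by omega
        rw [h3, h4, ← he, ← hg]; ring
      · rw [hE j (by omega), Polynomial.coeff_eq_zero_of_natDegree_lt (p := G) (by omega)]; simp
    · rw [hB']
      have := mulb _ _ _ _ (mulb _ _ _ _ bl bl) bs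
      rw [pow_two]; omega
    · intro j
      rw [hB', Polynomial.coeff_add, Polynomial.coeff_C_mul, Polynomial.coeff_C_mul_X_pow]
      refine (totalDegree_add _ _).trans (max_le ?_ ?_)
      · have := mulb _ _ _ _ bl (bG j); omega
      · split_ifs
        · exact (bE (2 * m - i - 1)).trans (by omega)
        · simp
    · intro j
      rw [hB', Polynomial.coeff_sub, Polynomial.coeff_sub, Polynomial.coeff_C_mul, Polynomial.coeff_C_mul,
        Polynomial.coeff_C_mul_X_pow, Polynomial.coeff_mul_X_pow']
      have be : e.totalDegree ≤ B := bE _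
      refine (totalDegree_sub _ _).trans (max_le ((totalDegree_sub _ _).trans (max_le ?_ ?_)) ?_)
      · have := mulb _ _ _ _ (mulb _ _ _ _ bl bl) (bE j)
        rw [pow_two]; omega
      · split_ifs
        · have := mulb _ _ _ _ (mulb _ _ _ _ (mulb _ _ _ _ b2.le bl) be) (bG (j - r))
          omega
        · simp
      · split_ifs
        · have := mulb _ _ _ _ be be
          rw [pow_two]; omega
        · simp

lemma aux_content {R : Type} [CommRing R] [IsDomain R] [UniqueFactorizationMonoid R]
    (p G : Polynomial R) (hp : p.IsPrimitive) (s : R) (hs : s ≠ 0)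
    (h : Polynomial.C s * p = G ^ 2) : ∃ (u : R) (G0 : Polynomial R), IsUnit u ∧
      p = Polynomial.C u * G0 ^ 2 := by
  classical
  let _ : StrongNormalizationMonoid R := UniqueFactorizationMonoid.strongNormalizationMonoid
  let _ : StrongNormalizedGCDMonoid R := UniqueFactorizationMonoid.toStrongNormalizedGCDMonoid R
  have h1 := congrArg Polynomial.content h
  rw [Polynomial.content_C_mul, hp.content_eq_one, mul_one, pow_two, Polynomial.content_mul] at h1
  have h2 : Associated s (G.content * G.content) := h1 ▸ (normalize_associated s).symm
  obtain ⟨u, hu⟩ := h2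
  refine ⟨u, G.primPart, u.isUnit, ?_⟩
  have hC : (Polynomial.C s : Polynomial R) ≠ 0 := by simpa using hs
  apply mul_left_cancel₀ hC
  rw [h, ← mul_assoc, ← Polynomial.C_mul, hu]
  conv_lhs => rw [G.eq_C_content_mul_primPart]
  rw [Polynomial.C_mul]; ring

lemma aux_zero {F : Type} [Field F] {n : ℕ} (r : MvPolynomial (Fin n) F) (hr : ¬ IsUnit r) :
    ∃ v : Fin n → AlgebraicClosure F, aeval v r = 0 := by
  by_contra! h
  have h1 : zeroLocus (AlgebraicClosure F) (Ideal.span {r}) = ∅ := by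
    rw [zeroLocus_span]; ext x; simp [h x]
  have h2 := vanishingIdeal_zeroLocus_eq_radical (K := AlgebraicClosure F) (Ideal.span {r})
  rw [h1, vanishingIdeal_empty] at h2
  rw [eq_comm, Ideal.radical_eq_top, Ideal.span_singleton_eq_top] at h2
  exact hr h2

lemma aux_square {L : Type} [Field L] [IsAlgClosed L] (p : Polynomial L)
    (h : ∀ a, Even (p.rootMultiplicity a)) : ∃ h, p = h ^ 2 := by
  classical
  choose e he using h
  obtain ⟨t, ht⟩ := IsAlgClosed.exists_pow_nat_eq p.leadingCoeff (n := 2) (by norm_num)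
  refine ⟨Polynomial.C t * ∏ a ∈ p.roots.toFinset, (Polynomial.X - Polynomial.C a) ^ e a, ?_⟩
  have h1 := (IsAlgClosed.splits p).eq_prod_roots
  rw [Polynomial.prod_multiset_root_eq_finset_root] at h1
  conv_lhs => rw [h1]
  rw [mul_pow, ← Finset.prod_pow, ← Polynomial.C_pow, ht]
  congr 1
  refine Finset.prod_congr rfl fun a _ => ?_
  rw [← pow_mul, he a]; congr 1; omega

lemma substX_eq {F : Type} [Field F] {n : ℕ} (f : MvPolynomial (Fin (n+1)) F) (u : Fin n → F) :
    substX f u = (finSuccEquiv F n f).map (eval u) := by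
  unfold substX
  induction f using MvPolynomial.induction_on with
  | C a => simp [finSuccEquiv_apply, Polynomial.algebraMap_eq]
  | add p q hp hq => simp only [map_add, hp, hq, Polynomial.map_add]
  | mul_X p i hp =>
    simp only [map_mul, hp, Polynomial.map_mul]
    congr 1
    refine Fin.cases ?_ (fun j => ?_) i
    · simp [finSuccEquiv_X_zero]
    · simp [finSuccEquiv_X_succ]

lemma substX_map {F L : Type} [Field F] [Field L] (φ : F →+* L) {n : ℕ}
    (f : MvPolynomial (Fin (n+1)) F) (u : Fin n → L) :
    substX (MvPolynomial.map φ f) u = (finSuccEquiv F n f).map (eval₂Hom φ u) := by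
  unfold substX
  induction f using MvPolynomial.induction_on with
  | C a => simp [finSuccEquiv_apply, Polynomial.algebraMap_eq]
  | add p q hp hq => simp only [map_add, hp, hq, Polynomial.map_add]
  | mul_X p i hp =>
    simp only [map_mul, hp, Polynomial.map_mul]
    congr 1
    refine Fin.cases ?_ (fun j => ?_) i
    · simp [finSuccEquiv_X_zero]
    · simp [finSuccEquiv_X_succ]

lemma map_substX {F L : Type} [Field F] [Field L] (φ : F →+* L) {n : ℕ}
    (f : MvPolynomial (Fin (n+1)) F) (u : Fin n → F) :
    (substX f u).map φ = substX (MvPolynomial.map φ f) (fun i => φ (u i)) := by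
  rw [substX_map, substX_eq, Polynomial.map_map]
  congr 1
  ext x <;> simp

lemma eval_substX {F : Type} [Field F] {n : ℕ} (f : MvPolynomial (Fin (n+1)) F) (u : Fin n → F)
    (t : F) : (substX f u).eval t = eval (Fin.cons t u : Fin (n+1) → F) f := by
  unfold substX
  induction f using MvPolynomial.induction_on with
  | C a => simp [Polynomial.algebraMap_eq]
  | add p q hp hq => simp only [map_add, hp, hq, Polynomial.eval_add]
  | mul_X p i hp =>
    simp only [map_mul, hp, Polynomial.eval_mul]
    congr 1
    refine Fin.cases ?_ (fun j => ?_) i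
    · simp
    · simp

lemma natDegree_substX {F : Type} [Field F] {n : ℕ} (f : MvPolynomial (Fin (n+1)) F)
    (u : Fin n → F) : (substX f u).natDegree ≤ f.totalDegree := by
  rw [substX_eq]
  exact (Polynomial.natDegree_map_le).trans
    ((natDegree_finSuccEquiv f).le.trans (degreeOf_le_totalDegree f 0))

/-- Swap symmetric. -/
lemma eval_swap {L : Type} [Field L] {n : ℕ} (f : MvPolynomial (Fin (n+1)) L) (hf : f.IsSymmetric)
    (a t : L) (w : Fin n → L) (i : Fin n) :
    eval (Fin.cons a (Function.update w i t) : Fin (n+1) → L) f =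
      eval (Fin.cons t (Function.update w i a) : Fin (n+1) → L) f := by
  conv_rhs => rw [← hf (Equiv.swap 0 i.succ)]
  rw [eval_rename]
  congr 2
  funext j
  simp only [Function.comp]
  refine Fin.cases ?_ (fun j => ?_) j
  · simp
  · by_cases h : j = i
    · subst h; simp
    · rw [Equiv.swap_apply_of_ne_of_ne (Fin.succ_ne_zero _) (by simpa using h)]
      simp [h]

lemma primitive_of_admissible {F : Type} [Field F] {n : ℕ} (f : MvPolynomial (Fin (n+1)) F)
    (hf : Admissible f) : (finSuccEquiv F n f).IsPrimitive := by
  intro r hr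
  by_contra hu
  obtain ⟨v, hv⟩ := aux_zero r hu
  apply hf.2 v
  erw [substX_map]
  obtain ⟨g, hg⟩ := hr
  rw [hg, Polynomial.map_mul, Polynomial.map_C]
  have : (eval₂Hom (algebraMap F (AlgebraicClosure F)) v) r = 0 := hv
  rw [this]; simp

lemma aux_Q {F : Type} [Field F] (h2 : (2:F) ≠ 0) {n : ℕ} (f : MvPolynomial (Fin (n+1)) F)
    (hf : Admissible f) : ∃ Q : MvPolynomial (Fin n) F, Q ≠ 0 ∧
      Q.totalDegree ≤ 3 * (3 ^ f.totalDegree * (2 * f.totalDegree)) ∧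
      ∀ v : Fin n → F, eval v Q ≠ 0 →
        ∀ h : Polynomial (AlgebraicClosure F),
          (substX f v).map (algebraMap F (AlgebraicClosure F)) ≠ h ^ 2 := by
  set L := AlgebraicClosure F
  set d := f.totalDegree with hd
  set p := finSuccEquiv F n f with hp
  have hprim : p.IsPrimitive := primitive_of_admissible f hf
  have hp0 : p ≠ 0 := hprim.ne_zero
  have hcoef : ∀ j, (p.coeff j).totalDegree ≤ d := by
    intro j
    by_cases h : p.coeff j = 0
    · rw [h]; simp
    · exact Nat.le_of_add_right_le (totalDegree_coeff_finSuccEquiv_add_le f j h)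
  have hdeg : p.natDegree ≤ d := (natDegree_finSuccEquiv f).le.trans (degreeOf_le_totalDegree f 0)
  have hmap : ∀ v, (substX f v).map (algebraMap F L) = p.map ((algebraMap F L).comp (eval v)) := by
    intro v; rw [substX_eq, Polynomial.map_map]
  have hinj : Function.Injective (algebraMap F L) := (algebraMap F L).injective
  have h2L : (2 : L) ≠ 0 := by
    intro h
    apply h2
    apply hinj
    rw [map_ofNat, map_zero]
    exact h
  rcases Nat.even_or_odd' p.natDegree with ⟨m, hm | hm⟩
  · obtain ⟨s, G, E, hs, hG, hGd, heq, hE, bs, bG, bE⟩ := aux_sqrt h2 d m p hp0 hm hcoef m le_rfl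
    have hE0 : E ≠ 0 := by
      rintro rfl
      rw [add_zero] at heq
      obtain ⟨u, G0, hu, hpe⟩ := aux_content p G hprim s hs heq
      rw [isUnit_iff_eq_C_of_isReduced] at hu
      obtain ⟨c, -, rfl⟩ := hu
      apply hf.1
      refine ⟨c, (finSuccEquiv F n).symm G0, ?_⟩
      apply (finSuccEquiv F n).injective
      have hc : finSuccEquiv F n (MvPolynomial.C c) = Polynomial.C (MvPolynomial.C c) := by
        simp [finSuccEquiv_apply]
      rw [← hp, hpe, map_mul, map_pow, AlgEquiv.apply_symm_apply, hc]
    obtain ⟨j, hj⟩ : ∃ j, E.coeff j ≠ 0 := by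
      by_contra! h; exact hE0 (Polynomial.ext (by simpa using h))
    refine ⟨s * G.coeff m * E.coeff j, mul_ne_zero (mul_ne_zero hs hG) hj, ?_, ?_⟩
    · have h3 : 3 ^ m * (2 * d) ≤ 3 ^ d * (2 * d) :=
        Nat.mul_le_mul_right _ (Nat.pow_le_pow_right (by norm_num) (by omega))
      have h4 := totalDegree_mul (s * G.coeff m) (E.coeff j)
      have h5 := totalDegree_mul s (G.coeff m)
      have h6 := bG m
      have h7 := bE j
      omega
    · intro v hv h hh
      rw [hmap] at hh
      set φ := (algebraMap F L).comp (eval v) with hφ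
      simp only [map_mul, mul_ne_zero_iff] at hv
      have hφne : ∀ r, eval v r ≠ 0 → φ r ≠ 0 := fun r hr => by
        simpa [hφ] using hr
      obtain ⟨⟨hvs, hvg⟩, hve⟩ := hv
      have heq' := congrArg (Polynomial.map φ) heq
      simp only [Polynomial.map_mul, Polynomial.map_add, Polynomial.map_pow, Polynomial.map_C] at heq'
      rw [hh] at heq'
      obtain ⟨t, ht⟩ := IsAlgClosed.exists_pow_nat_eq (φ s) (n := 2) (by norm_num)
      have hfac : (Polynomial.C t * h - G.map φ) * (Polynomial.C t * h + G.map φ) = E.map φ := by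
        rw [← ht, Polynomial.C_pow] at heq'
        linear_combination heq'
      have hEφ : E.map φ ≠ 0 := by
        intro h0
        have := congrArg (fun P => Polynomial.coeff P j) h0
        simp only [Polynomial.coeff_map, Polynomial.coeff_zero] at this
        exact hφne _ hve this
      have hm0 : m ≠ 0 := by
        rintro rfl
        exact hj (hE j (by omega))
      have hEdeg : (E.map φ).natDegree < m := by
        rw [Polynomial.natDegree_lt_iff_degree_lt hEφ, Polynomial.degree_lt_iff_coeff_zero]
        intro r hr
        rw [Polynomial.coeff_map, hE r (by omega), map_zero]
      have hne := mul_ne_zero_iff.mp (hfac ▸ hEφ)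
      have hsum : (E.map φ).natDegree = _ := hfac ▸ Polynomial.natDegree_mul hne.1 hne.2
      have c1 := Polynomial.coeff_eq_zero_of_natDegree_lt
        (p := Polynomial.C t * h - G.map φ) (n := m) (by omega)
      have c2 := Polynomial.coeff_eq_zero_of_natDegree_lt
        (p := Polynomial.C t * h + G.map φ) (n := m) (by omega)
      simp only [Polynomial.coeff_sub, Polynomial.coeff_add, Polynomial.coeff_map] at c1 c2
      apply hφne _ hvg
      have : (2 : L) * φ (G.coeff m) = 0 := by linear_combination c2 - c1
      exact (mul_eq_zero.mp this).resolve_left h2L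
  · refine ⟨p.leadingCoeff, Polynomial.leadingCoeff_ne_zero.mpr hp0, ?_, ?_⟩
    · have h1 := hcoef p.natDegree
      have h3 : 1 ≤ 3 ^ d := Nat.one_le_pow _ _ (by norm_num)
      rw [Polynomial.leadingCoeff]
      nlinarith
    · intro v hv h hh
      rw [hmap] at hh
      have h3 := congrArg Polynomial.natDegree hh
      rw [Polynomial.natDegree_map_of_leadingCoeff_ne_zero _ (by simpa using hv),
        Polynomial.natDegree_pow] at h3
      omega

lemma count_lines {U F : Type} [Fintype U] [Fintype F] [DecidableEq U] [DecidableEq F]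
    (op : U → F → U) (get : U → F)
    (h1 : ∀ w s, op (op w s) (get w) = w) (h2 : ∀ w s, get (op w s) = s)
    (T : Finset U) (D : ℕ) (hT : ∀ u, (Finset.univ.filter fun t => op u t ∈ T).card ≤ D) :
    Fintype.card F * T.card ≤ D * Fintype.card U := by
  have e1 : (T ×ˢ (Finset.univ : Finset F)).card ≤
      ((Finset.univ : Finset U).sigma fun u => Finset.univ.filter fun t => op u t ∈ T).card := by
    refine Finset.card_le_card_of_injOn (fun x => ⟨op x.1 x.2, get x.1⟩) ?_ ?_
    · intro x hx
      have : x.1 ∈ T := by simpa using hx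
      simp [h1, this]
    · rintro ⟨a, b⟩ - ⟨a', b'⟩ - h
      simp only [Sigma.mk.injEq, heq_eq_eq] at h
      have hb : b = b' := by rw [← h2 a b, h.1, h2]
      have ha : a = a' := by rw [← h1 a b, h.1, h.2, h1]
      rw [ha, hb]
  rw [Finset.card_product, Finset.card_sigma, Finset.card_univ] at e1
  have e2 := Finset.sum_le_card_nsmul (Finset.univ : Finset U) _ D (fun u _ => hT u)
  rw [Finset.card_univ, smul_eq_mul] at e2
  calc _ = T.card * Fintype.card F := mul_comm _ _
    _ ≤ _ := e1.trans e2
    _ = _ := mul_comm _ _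

lemma tdeg_map {F L σ : Type} [Field F] [Field L] (φ : F →+* L) (f : MvPolynomial σ F) :
    (MvPolynomial.map φ f).totalDegree ≤ f.totalDegree := by
  unfold totalDegree
  exact Finset.sup_mono (support_map_subset φ f)

lemma aux_even {L : Type} [Field L] (A P g : Polynomial L) (c a : L) (hAP : A * P ≠ 0)
    (hPr : ¬ P.IsRoot a) (h1 : A * P = Polynomial.C c * g ^ 2) :
    Even (A.rootMultiplicity a) := by
  have h3 := congrArg (Polynomial.rootMultiplicity a) h1
  have h4 : Polynomial.C c * g ^ 2 ≠ 0 := h1 ▸ hAP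
  have h5 : g ^ 2 ≠ 0 := right_ne_zero_of_mul h4
  rw [Polynomial.rootMultiplicity_mul hAP, Polynomial.rootMultiplicity_eq_zero hPr,
    Polynomial.rootMultiplicity_mul h4, Polynomial.rootMultiplicity_C, pow_two,
    Polynomial.rootMultiplicity_mul (pow_two g ▸ h5)] at h3
  exact ⟨_, by simpa using h3⟩

lemma count_Q {F : Type} [Field F] [Fintype F] [DecidableEq F] {n : ℕ} (Q : MvPolynomial (Fin n) F)
    (hQ : Q ≠ 0) :
    Fintype.card F * (Finset.univ.filter fun u : Fin n → Bool → F =>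
      eval (fun i => u i false) Q = 0).card ≤ Q.totalDegree * Fintype.card (Fin n → Bool → F) := by
  have hq : 0 < Fintype.card F := Fintype.card_pos
  have h := schwartz_zippel_totalDegree hQ (Finset.univ : Finset F)
  rw [Fintype.piFinset_univ, Finset.card_univ, div_le_div_iff₀ (by positivity) (by positivity)] at h
  have h' : (Finset.univ.filter fun v : Fin n → F => eval v Q = 0).card * Fintype.card F
      ≤ Q.totalDegree * Fintype.card F ^ n := by exact_mod_cast h
  have e : (Finset.univ.filter fun u : Fin n → Bool → F => eval (fun i => u i false) Q = 0).card
      ≤ ((Finset.univ.filter fun v : Fin n → F => eval v Q = 0) ×ˢ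
        (Finset.univ : Finset (Fin n → F))).card := by
    refine Finset.card_le_card_of_injOn (fun u => (fun i => u i false, fun i => u i true)) ?_ ?_
    · intro u hu
      simpa using hu
    · intro u _ u' _ h
      simp only [Prod.mk.injEq, funext_iff] at h
      funext i b
      cases b
      · exact h.1 i
      · exact h.2 i
  rw [Finset.card_product, Finset.card_univ, Fintype.card_fun, Fintype.card_fin] at e
  have hU : Fintype.card (Fin n → Bool → F) = Fintype.card F ^ n * Fintype.card F ^ n := by
    simp only [Fintype.card_fun, Fintype.card_fin, Fintype.card_bool]; ring
  rw [hU]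
  calc _ ≤ Fintype.card F * _ := Nat.mul_le_mul_left _ e
    _ = ((Finset.univ.filter fun v : Fin n → F => eval v Q = 0).card * Fintype.card F)
        * Fintype.card F ^ n := by ring
    _ ≤ _ := Nat.mul_le_mul_right _ h'
    _ = _ := by ring

lemma prod_root {ι L : Type} [Fintype ι] [Field L] (A : ι → Polynomial L)
    (hA : ∀ i, A i ≠ 0) (z : ι) (a c : L) (g : Polynomial L)
    (h1 : ∏ i, A i = Polynomial.C c * g ^ 2) (hodd : ¬ Even ((A z).rootMultiplicity a)) :
    ∃ i, i ≠ z ∧ (A i).eval a = 0 := by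
  classical
  by_contra! hcon
  rw [← Finset.mul_prod_erase _ _ (Finset.mem_univ z)] at h1
  apply hodd
  refine aux_even _ _ g c a ?_ ?_ h1
  · exact mul_ne_zero (hA z) (Finset.prod_ne_zero_iff.mpr fun i _ => hA i)
  · rw [Polynomial.IsRoot.def, Polynomial.eval_prod, Finset.prod_eq_zero_iff]
    rintro ⟨i, hi, h0⟩
    exact hcon i (Finset.ne_of_mem_erase hi) h0

lemma bad_root {F L : Type} [Field F] [Field L] (φ : F →+* L)
    {n : ℕ} (f : MvPolynomial (Fin (n+1)) F)
    (hne : ∀ w : Fin n → L, substX (MvPolynomial.map φ f) w ≠ 0)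
    (u : Fin n → Bool → F) (hu : u ∈ badSet f) (a : L)
    (hodd : ¬ Even (((substX f (fun i => u i false)).map φ).rootMultiplicity a)) :
    ∃ ε : Fin n → Bool, ε ≠ (fun _ => false) ∧
      (substX (MvPolynomial.map φ f) (fun i => φ (u i (ε i)))).eval a = 0 := by
  obtain ⟨c, g, hcg⟩ := hu
  have h1 := congrArg (Polynomial.map φ) hcg
  rw [Polynomial.map_prod, Polynomial.map_mul, Polynomial.map_pow, Polynomial.map_C] at h1
  obtain ⟨ε, hε, h0⟩ := prod_root
    (fun ε : Fin n → Bool => (substX f (fun i => u i (ε i))).map φ) (fun ε =>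
      (map_substX φ f (fun i => u i (ε i))).trans_ne (hne _)) (fun _ => false) a (φ c) (g.map φ) h1 hodd
  exact ⟨ε, hε, (congrArg (Polynomial.eval a) (map_substX φ f (fun i => u i (ε i)))).symm.trans h0⟩

lemma main_count_aux {F L : Type} [Field F] [Fintype F] [Field L] [IsAlgClosed L] (φ : F →+* L)
    {n : ℕ} (f : MvPolynomial (Fin (n+1)) F) (hsym : f.IsSymmetric)
    (hne : ∀ w : Fin n → L, substX (MvPolynomial.map φ f) w ≠ 0)
    (d : ℕ) (hd : f.totalDegree ≤ d) (K : ℕ)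
    (Q : MvPolynomial (Fin n) F) (hQ0 : Q ≠ 0) (hQd : Q.totalDegree ≤ K)
    (hQ : ∀ v : Fin n → F, eval v Q ≠ 0 → ∀ h : Polynomial L, (substX f v).map φ ≠ h ^ 2) :
    Fintype.card F * (badSet f).ncard ≤ (K + 2 ^ n * d) * Fintype.card (Fin n → Bool → F) := by
  classical
  set fL := MvPolynomial.map φ f with hfL
  have hsymL : fL.IsSymmetric := hsym.map φ
  have hdL : fL.totalDegree ≤ d :=
    (tdeg_map φ f).trans hd
  have hα : ∀ v : Fin n → F, ∃ a : L, eval v Q ≠ 0 →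
      ¬ Even (((substX f v).map φ).rootMultiplicity a) := by
    intro v
    by_cases hv : eval v Q = 0
    · exact ⟨0, fun h => absurd hv h⟩
    · by_contra! h
      obtain ⟨g, hg⟩ := aux_square ((substX f v).map φ) (fun a => (h a).2)
      exact hQ v hv g hg
  choose α hα using hα
  set T0 := Finset.univ.filter fun u : Fin n → Bool → F => eval (fun i => u i false) Q = 0 with hT0
  set T : (Fin n → Bool) → Finset (Fin n → Bool → F) := fun ε =>
    Finset.univ.filter fun u => (substX fL (fun i => φ (u i (ε i)))).eval (α (fun i => u i false)) = 0
    with hT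
  set z : Fin n → Bool := fun _ => false with hz
  have hsub : badSet f ⊆ ((T0 ∪ (Finset.univ.erase z).biUnion T : Finset _) :
      Set (Fin n → Bool → F)) := by
    intro u hu
    by_contra hcon
    simp only [Finset.coe_union, Set.mem_union, Finset.mem_coe, Finset.mem_biUnion, not_or,
      not_exists, not_and, Finset.mem_erase, Finset.mem_univ, and_true] at hcon
    obtain ⟨hc1, hc2⟩ := hcon
    have hv : eval (fun i => u i false) Q ≠ 0 := by simpa [hT0] using hc1
    have hodd := hα _ hv
    set a := α (fun i => u i false) with ha
    obtain ⟨ε, hε, h0⟩ := bad_root φ f hne u hu a hodd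
    exact hc2 ε hε (Finset.mem_filter.mpr ⟨Finset.mem_univ _, h0⟩)
  have hTc : ∀ ε ∈ Finset.univ.erase z, Fintype.card F * (T ε).card ≤
      d * Fintype.card (Fin n → Bool → F) := by
    intro ε hε
    obtain ⟨i, hi⟩ : ∃ i, ε i = true := by
      by_contra! h
      exact Finset.ne_of_mem_erase hε (funext fun i => by simpa [hz] using h i)
    refine count_lines (fun (u : Fin n → Bool → F) (t : F) => Function.update u i (Function.update (u i) true t))
      (fun u : Fin n → Bool → F => u i true) (by intros; simp) (by intros; simp) (T ε) d ?_
    intro u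
    set a := α (fun i => u i false) with ha
    set w : Fin n → L := fun j => φ (u j (ε j)) with hw
    set R := substX fL (Function.update w i a) with hR
    have hRd : R.natDegree ≤ d := (natDegree_substX _ _).trans hdL
    refine le_trans ?_ ((Multiset.toFinset_card_le _).trans ((Polynomial.card_roots' R).trans hRd))
    refine Finset.card_le_card_of_injOn φ ?_ φ.injective.injOn
    intro t ht
    simp only [hT, Finset.coe_filter, Finset.mem_filter, Finset.mem_univ, true_and,
      Set.mem_ofPred_eq] at ht
    have e1 : (fun j => (Function.update u i (Function.update (u i) true t)) j false)
        = fun j => u j false := by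
      funext j
      by_cases h : j = i
      · subst h; simp
      · simp [h]
    have e2 : (fun j => φ ((Function.update u i (Function.update (u i) true t)) j (ε j)))
        = Function.update w i (φ t) := by
      funext j
      by_cases h : j = i
      · subst h; simp [hi]
      · simp [h, hw]
    have ht2 : (substX fL (Function.update w i (φ t))).eval a = 0 := by
      rw [← e2, ha, ← e1]; exact ht
    rw [eval_substX, eval_swap _ hsymL, ← eval_substX] at ht2
    simp only [Finset.mem_coe, Multiset.mem_toFinset]
    exact (Polynomial.mem_roots (hne _)).mpr ht2
  have hcard : (badSet f).ncard ≤ T0.card + ∑ ε ∈ Finset.univ.erase z, (T ε).card := by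
    refine (Set.ncard_le_ncard hsub (Finset.finite_toSet _)).trans ?_
    rw [Set.ncard_coe_finset]
    exact (Finset.card_union_le _ _).trans (Nat.add_le_add_left Finset.card_biUnion_le _)
  have hs : ∑ ε ∈ Finset.univ.erase z, Fintype.card F * (T ε).card ≤
      2 ^ n * (d * Fintype.card (Fin n → Bool → F)) := by
    refine (Finset.sum_le_card_nsmul _ _ _ hTc).trans ?_
    rw [smul_eq_mul]
    refine Nat.mul_le_mul_right _ ?_
    refine (Finset.card_le_univ _).trans ?_
    simp
  have h0 := (count_Q Q hQ0).trans (Nat.mul_le_mul_right _ hQd)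
  calc _ ≤ Fintype.card F * (T0.card + ∑ ε ∈ Finset.univ.erase z, (T ε).card) :=
        Nat.mul_le_mul_left _ hcard
    _ = Fintype.card F * T0.card + ∑ ε ∈ Finset.univ.erase z, Fintype.card F * (T ε).card := by
        rw [mul_add, Finset.mul_sum]
    _ ≤ _ := add_le_add h0 hs
    _ = _ := by ring

lemma main_count {F : Type} [Field F] [Fintype F] (h2 : (2:F) ≠ 0) {n : ℕ}
    (f : MvPolynomial (Fin (n+1)) F) (hsym : f.IsSymmetric) (hf : Admissible f) :
    Fintype.card F * (badSet f).ncard ≤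
      (3 * (3 ^ f.totalDegree * (2 * f.totalDegree)) + 2 ^ n * f.totalDegree) *
        Fintype.card (Fin n → Bool → F) := by
  obtain ⟨Q, hQ0, hQd, hQ⟩ := aux_Q h2 f hf
  exact main_count_aux (algebraMap F (AlgebraicClosure F)) f hsym hf.2 _ le_rfl _ Q hQ0 hQd hQ

theorem stmt_9 (k d : ℕ) (hk : 2 ≤ k) (hd : 1 ≤ d) :
    ∃ C : ℝ, 0 < C ∧
      ∀ (q : ℕ) (F : Type) [Field F] [Fintype F],
        Fintype.card F = q → Odd q →
        ∀ f : MvPolynomial (Fin k) F, f.IsSymmetric → f.totalDegree = d → Admissible f →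
          (Set.ncard (badSet f) : ℝ) ≤ C * (q : ℝ) ^ (2 * k - 3) := by
  obtain ⟨n, rfl⟩ : ∃ n, k = n + 2 := ⟨k - 2, by omega⟩
  refine ⟨((3 * (3 ^ d * (2 * d)) + 2 ^ (n+1) * d : ℕ) : ℝ), by positivity, ?_⟩
  intro q F _ _ hq hodd f hsym hdeg hf
  have h2 : (2:F) ≠ 0 := by
    apply Ring.two_ne_zero
    intro h
    have := FiniteField.even_card_of_char_two h
    rw [hq] at this
    have := Nat.odd_iff.mp hodd
    omega
  have h := main_count (n := n + 1) h2 f hsym hf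
  have hU : Fintype.card (Fin (n+1) → Bool → F) = q * q ^ (2 * (n+2) - 3) := by
    simp only [Fintype.card_fun, Fintype.card_fin, Fintype.card_bool]
    rw [hq, ← pow_mul, ← pow_succ']; congr 1
  have hq0 : 0 < q := hq ▸ Fintype.card_pos
  rw [hU, hdeg, hq, mul_left_comm] at h
  exact_mod_cast Nat.le_of_mul_le_mul_left h hq0
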